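/- For all integers n ≥ 1 and k ≥ 0, the poly-Bernoulli number with negative upper index B_{n,k} = Σ_{m=0}^{n} (−1)^{n+m} · m! · S(n,m) · (m+1)^k admits the closed form B_{n,k} = Σ_{m=1}^{n} (−1)^{n+m} · m! · S(n,m) · (m+1)^k (the m=0 term vanishes since S(n,0)=0 for n ≥ 1); equivalently, for all n ≥ 1 and k ≥ 0, (−1)^n · Σ_{m=1}^{n} Σ_{ℓ=1}^{m} m! · S(n,m) · S(m,ℓ) · (−1)^ℓ · ĉ_{ℓ,k} = Σ_{m=1}^{n} (−1)^{n+m} · m! · S(n,m) · (m+1)^k. -/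

import Mathlib

/-- Unsigned Stirling numbers of the first kind:
`c(0,0)=1`, `c(n,m)=0` for `m>n` or (`n>0` and `m=0`), and `c(n+1,m)=n*c(n,m)+c(n,m-1)`. -/
def stirling1 : ℕ → ℕ → ℕ
  | 0, 0 => 1
  | 0, _ + 1 => 0
  | _ + 1, 0 => 0
  | n + 1, m + 1 => n * stirling1 n (m + 1) + stirling1 n m

/-- Stirling numbers of the second kind:
`S(0,0)=1`, `S(n,m)=0` for `m>n` or (`n>0` and `m=0`), and `S(n+1,m)=m*S(n,m)+S(n,m-1)`. -/
def stirling2 : ℕ → ℕ → ℕ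
  | 0, 0 => 1
  | 0, _ + 1 => 0
  | _ + 1, 0 => 0
  | n + 1, m + 1 => (m + 1) * stirling2 n (m + 1) + stirling2 n m

/-- Poly-Cauchy numbers of the second kind (negated upper index, unsigned):
`ĉ_{n,k} = Σ_{m=0}^n c(n,m)·(m+1)^k`. -/
def polyCauchy (n k : ℕ) : ℕ := ∑ m ∈ Finset.range (n + 1), stirling1 n m * (m + 1) ^ k

/-- Poly-Bernoulli numbers with negative upper index:
`B_{n,k} = Σ_{m=0}^n (−1)^{n+m}·m!·S(n,m)·(m+1)^k`. -/
def polyBernoulli (n k : ℕ) : ℤ :=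
  ∑ m ∈ Finset.range (n + 1),
    (-1) ^ (n + m) * (Nat.factorial m : ℤ) * stirling2 n m * (m + 1) ^ k

theorem stirling1_eq_zero_of_lt : ∀ {n m : ℕ}, n < m → stirling1 n m = 0
  | 0, _ + 1, _ => by simp [stirling1]
  | n + 1, m + 1, h => by
    simp [stirling1, stirling1_eq_zero_of_lt (show n < m by lia),
      stirling1_eq_zero_of_lt (show n < m + 1 by lia)]

theorem stirling2_eq_zero_of_lt : ∀ {n m : ℕ}, n < m → stirling2 n m = 0
  | 0, _ + 1, _ => by simp [stirling2]
  | n + 1, m + 1, h => by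
    simp [stirling2, stirling2_eq_zero_of_lt (show n < m by lia),
      stirling2_eq_zero_of_lt (show n < m + 1 by lia)]

theorem stirling2_zero_right {n : ℕ} (hn : 1 ≤ n) : stirling2 n 0 = 0 := by
  obtain ⟨n, rfl⟩ := Nat.exists_eq_add_of_le' hn
  simp [stirling2]

theorem sum_range_shift {N : ℕ} {g : ℕ → ℤ} (h : g 0 = g N) :
    ∑ j ∈ Finset.range N, g (j + 1) = ∑ j ∈ Finset.range N, g j := by
  have := (Finset.sum_range_succ' g N).symm.trans (Finset.sum_range_succ g N)
  linarith

theorem sum_range_succ_eq_sum_Icc_one {g : ℕ → ℤ} (h : g 0 = 0) (n : ℕ) :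
    ∑ m ∈ Finset.range (n + 1), g m = ∑ m ∈ Finset.Icc 1 n, g m := by
  rw [Finset.range_eq_Ico, Finset.sum_eq_sum_Ico_succ_bot (Nat.succ_pos n), h, zero_add]
  rfl

theorem sum_stirling1_succ (n : ℕ) (f : ℕ → ℤ) :
    ∑ j ∈ Finset.range (n + 2), (stirling1 (n + 1) j : ℤ) * f j =
      n * ∑ j ∈ Finset.range (n + 1), (stirling1 n j : ℤ) * f j +
        ∑ j ∈ Finset.range (n + 1), (stirling1 n j : ℤ) * f (j + 1) := by
  have h0 : n * (stirling1 n 0 : ℤ) = 0 := by cases n <;> simp [stirling1]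
  rw [Finset.sum_range_succ', Finset.mul_sum,
    ← sum_range_shift (g := fun j => (n : ℤ) * (stirling1 n j * f j))]
  · simp only [stirling1, ← Finset.sum_add_distrib]
    push_cast
    rw [zero_mul, add_zero]
    exact Finset.sum_congr rfl fun j _ => by ring
  · rw [← mul_assoc, h0, stirling1_eq_zero_of_lt (Nat.lt_succ_self n)]
    simp

theorem sum_stirling2_succ (n : ℕ) (a : ℕ → ℤ) :
    ∑ l ∈ Finset.range (n + 2), (stirling2 (n + 1) l : ℤ) * a l =
      ∑ l ∈ Finset.range (n + 1), (stirling2 n l : ℤ) * (l * a l + a (l + 1)) := by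
  simp only [mul_add, Finset.sum_add_distrib]
  rw [Finset.sum_range_succ',
    ← sum_range_shift (g := fun l => (stirling2 n l : ℤ) * (l * a l))]
  · simp only [stirling2, ← Finset.sum_add_distrib]
    push_cast
    rw [zero_mul, add_zero]
    exact Finset.sum_congr rfl fun j _ => by ring
  · simp [stirling2_eq_zero_of_lt (Nat.lt_succ_self n)]

/-- Inversion between the two kinds of Stirling numbers. -/
theorem sum_stirling2_mul_sum_stirling1 (n : ℕ) (f : ℕ → ℤ) :
    ∑ l ∈ Finset.range (n + 1), (stirling2 n l : ℤ) *
      ((-1) ^ l * ∑ j ∈ Finset.range (l + 1), (stirling1 l j : ℤ) * f j) = (-1) ^ n * f n := by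
  induction n generalizing f with
  | zero => simp [stirling1, stirling2]
  | succ n ih =>
    rw [sum_stirling2_succ, pow_succ, mul_neg_one, neg_mul, ← ih fun j => f (j + 1),
      ← Finset.sum_neg_distrib]
    refine Finset.sum_congr rfl fun l _ => ?_
    rw [sum_stirling1_succ]
    ring

theorem sum_stirling2_mul_polyCauchy {m : ℕ} (hm : 1 ≤ m) (k : ℕ) :
    ∑ l ∈ Finset.Icc 1 m, (stirling2 m l : ℤ) * ((-1) ^ l * polyCauchy l k) =
      (-1) ^ m * (m + 1) ^ k := by
  rw [← sum_range_succ_eq_sum_Icc_one (by simp [stirling2_zero_right hm]),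
    ← sum_stirling2_mul_sum_stirling1 m fun j => ((j : ℤ) + 1) ^ k]
  simp [polyCauchy]

theorem polyBernoulli_closed_form (n k : ℕ) (hn : 1 ≤ n) :
    polyBernoulli n k
        = ∑ m ∈ Finset.Icc 1 n, (-1 : ℤ) ^ (n + m) * (Nat.factorial m : ℤ)
            * stirling2 n m * (m + 1) ^ k
      ∧ (-1 : ℤ) ^ n * ∑ m ∈ Finset.Icc 1 n, ∑ ℓ ∈ Finset.Icc 1 m,
            (Nat.factorial m : ℤ) * stirling2 n m * stirling2 m ℓ * (-1) ^ ℓ * polyCauchy ℓ k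
          = ∑ m ∈ Finset.Icc 1 n, (-1 : ℤ) ^ (n + m) * (Nat.factorial m : ℤ)
              * stirling2 n m * (m + 1) ^ k := by
  constructor
  · exact sum_range_succ_eq_sum_Icc_one (by simp [stirling2_zero_right hn]) n
  · rw [Finset.mul_sum]
    refine Finset.sum_congr rfl fun m hm => ?_
    simp only [mul_assoc, ← Finset.mul_sum]
    rw [sum_stirling2_mul_polyCauchy (Finset.mem_Icc.mp hm).1]
    ring
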